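/- Let r be a finite set of tuples over a schema whose attributes have linearly ordered domains, and let X = [X_1, ..., X_k] and Y = [Y_1, ..., Y_l] be lists of attributes. Then X ~ Y holds in r iff for all 1 ≤ i ≤ k and 1 ≤ j ≤ l, the canonical order compatibility [{X_1, ..., X_{i-1}} ∪ {Y_1, ..., Y_{j-1}}]: X_i ~ Y_j holds in r. -/

import Mathlib

/-- Lexicographic comparison of two tuples with respect to a list of
attributes: `s ⪯_X t`. -/
def lexLe {A : Type*} {D : A → Type*} [∀ a, LinearOrder (D a)] :
    List A → (∀ a, D a) → (∀ a, D a) → Prop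
  | [], _, _ => True
  | a :: X, s, t => s a < t a ∨ (s a = t a ∧ lexLe X s t)

/-- The order dependency `X ↦ Y` holds in `r`. -/
def ODholds {A : Type*} {D : A → Type*} [∀ a, LinearOrder (D a)]
    (r : Set (∀ a, D a)) (X Y : List A) : Prop :=
  ∀ s ∈ r, ∀ t ∈ r, lexLe X s t → lexLe Y s t

/-- Order compatibility `X ~ Y`: both `XY ↦ YX` and `YX ↦ XY` hold. -/
def OCholds {A : Type*} {D : A → Type*} [∀ a, LinearOrder (D a)]
    (r : Set (∀ a, D a)) (X Y : List A) : Prop :=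
  ODholds r (X ++ Y) (Y ++ X) ∧ ODholds r (Y ++ X) (X ++ Y)

/-- Strict lexicographic comparison. -/
def lexLtAux {A : Type*} {D : A → Type*} [∀ a, LinearOrder (D a)] :
    List A → (∀ a, D a) → (∀ a, D a) → Prop
  | [], _, _ => False
  | a :: X, s, t => s a < t a ∨ (s a = t a ∧ lexLtAux X s t)

theorem lexLtAux_iff {A : Type*} {D : A → Type*} [∀ a, LinearOrder (D a)]
    (X : List A) (s t : ∀ a, D a) :
    lexLtAux X s t ↔ ∃ i : Fin X.length,
      (∀ a ∈ X.take i.1, s a = t a) ∧ s (X.get i) < t (X.get i) := by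
  induction X with
  | nil => simp [lexLtAux]
  | cons a X ih =>
    rw [lexLtAux, ih]
    constructor
    · rintro (h | ⟨h, i, h1, h2⟩)
      · exact ⟨⟨0, by simp⟩, by simp, h⟩
      · refine ⟨i.succ, ?_, h2⟩
        simpa using ⟨h, by simpa using h1⟩
    · rintro ⟨⟨i, hi⟩, h1, h2⟩
      cases i with
      | zero => exact Or.inl h2
      | succ i =>
        simp only [List.take_succ_cons, List.mem_cons, forall_eq_or_imp] at h1
        exact Or.inr ⟨h1.1, ⟨i, by simpa using hi⟩, h1.2, h2⟩

theorem not_lexLtAux {A : Type*} {D : A → Type*} [∀ a, LinearOrder (D a)]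
    (X : List A) (s t : ∀ a, D a) : ¬ lexLtAux X t s ↔ lexLe X s t := by
  induction X with
  | nil => simp [lexLtAux, lexLe]
  | cons a X ih =>
    rw [lexLtAux, lexLe, ← ih]
    rcases lt_trichotomy (s a) (t a) with h | h | h
    · simp [h, h.not_gt, h.ne']
    · simp [h]
    · simp [h, h.not_gt, h.ne']

theorem lexLe_append {A : Type*} {D : A → Type*} [∀ a, LinearOrder (D a)]
    (X Y : List A) (s t : ∀ a, D a) :
    lexLe (X ++ Y) s t ↔ lexLtAux X s t ∨ (lexLe X s t ∧ lexLe Y s t) := by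
  induction X with
  | nil => simp [lexLtAux, lexLe]
  | cons a X ih =>
    rw [List.cons_append, lexLtAux, lexLe, lexLe, ih]
    rcases lt_trichotomy (s a) (t a) with h | h | h
    · simp [h]
    · simp [h]
    · simp [h.not_gt, h.ne']

theorem lexLe_of_lexLtAux {A : Type*} {D : A → Type*} [∀ a, LinearOrder (D a)]
    (X : List A) (s t : ∀ a, D a) (h : lexLtAux X s t) : lexLe X s t := by
  induction X with
  | nil => trivial
  | cons a X ih => exact h.imp id (fun h => ⟨h.1, ih h.2⟩)

theorem OCholds_iff_aux {A : Type*} {D : A → Type*} [∀ a, LinearOrder (D a)]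
    (r : Set (∀ a, D a)) (X Y : List A) :
    OCholds r X Y ↔ ∀ s ∈ r, ∀ t ∈ r, ¬ (lexLtAux X s t ∧ lexLtAux Y t s) := by
  simp only [OCholds, ODholds, lexLe_append]
  constructor
  · rintro ⟨h, -⟩ s hs t ht ⟨h1, h2⟩
    rcases h s hs t ht (Or.inl h1) with h3 | h3
    · exact (not_lexLtAux Y s t).2 (lexLe_of_lexLtAux Y s t h3) h2
    · exact (not_lexLtAux Y s t).2 h3.1 h2
  · intro h
    constructor
    · rintro s hs t ht (h1 | h1)
      · exact Or.inr ⟨(not_lexLtAux Y s t).1 fun h2 => h s hs t ht ⟨h1, h2⟩,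
          lexLe_of_lexLtAux X s t h1⟩
      · exact Or.inr h1.symm
    · rintro s hs t ht (h1 | h1)
      · exact Or.inr ⟨(not_lexLtAux X s t).1 fun h2 => h t ht s hs ⟨h2, h1⟩,
          lexLe_of_lexLtAux Y s t h1⟩
      · exact Or.inr h1.symm

/-- `X ~ Y` holds in the finite set of tuples `r` iff for all `i, j`, the
canonical order compatibility `[{X_1, ..., X_{i-1}} ∪ {Y_1, ..., Y_{j-1}}]:
X_i ~ Y_j` holds in `r`: within every partition group of `r` by the attributes
of the two prefixes, there is no swap between `X_i` and `Y_j`. -/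
theorem stmt17 {A : Type*} {D : A → Type*} [∀ a, LinearOrder (D a)]
    (r : Set (∀ a, D a)) (hfin : r.Finite) (X Y : List A) :
    OCholds r X Y ↔
      (∀ (i : Fin X.length) (j : Fin Y.length), ∀ s ∈ r, ∀ t ∈ r,
        ((∀ a ∈ X.take i.1, s a = t a) ∧ (∀ a ∈ Y.take j.1, s a = t a)) →
          ¬ (s (X.get i) < t (X.get i) ∧ t (Y.get j) < s (Y.get j))) := by
  rw [OCholds_iff_aux]
  simp only [lexLtAux_iff]
  constructor
  · rintro h i j s hs t ht ⟨h1, h2⟩ ⟨h3, h4⟩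
    exact h s hs t ht ⟨⟨i, h1, h3⟩, ⟨j, fun a ha => (h2 a ha).symm, h4⟩⟩
  · rintro h s hs t ht ⟨⟨i, h1, h3⟩, ⟨j, h2, h4⟩⟩
    exact h i j s hs t ht ⟨h1, fun a ha => (h2 a ha).symm⟩ ⟨h3, h4⟩
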